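/- Let p ≥ 3(2+√2)/8. For all r ∈ (0,1), K(1/2)/2^{p-1} ≤ r^p·K(1-r) + (1-r)^p·K(r) < π/2, with equality on the left only if r = 1/2. -/

import Mathlib

open Real Set Filter

noncomputable def K (x : ℝ) : ℝ :=
  ∫ t in (0 : ℝ)..(π / 2), (1 - x * Real.sin t ^ 2) ^ (-(1/2) : ℝ)

noncomputable def E (x : ℝ) : ℝ :=
  ∫ t in (0 : ℝ)..(π / 2), (1 - x * Real.sin t ^ 2) ^ ((1/2) : ℝ)

noncomputable def cc (n : ℕ) : ℝ := Ring.multichoose (1/2 : ℝ) n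

lemma cc_zero : cc 0 = 1 := by simp [cc]

lemma cc_succ (n : ℕ) : cc (n+1) * (n+1) = cc n * (n + 1/2) := by
  have h1 := Ring.factorial_nsmul_multichoose_eq_ascPochhammer (1/2 : ℝ) n
  have h2 := Ring.factorial_nsmul_multichoose_eq_ascPochhammer (1/2 : ℝ) (n+1)
  rw [Polynomial.ascPochhammer_smeval_eq_eval] at h1 h2
  rw [ascPochhammer_succ_eval, ← h1] at h2
  simp only [nsmul_eq_mul, Nat.factorial_succ] at h2
  push_cast at h2
  have hf : (n.factorial : ℝ) ≠ 0 := by positivity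
  unfold cc
  apply mul_left_cancel₀ hf
  linear_combination h2

lemma cc_pos (n : ℕ) : 0 < cc n := by
  induction n with
  | zero => simp [cc_zero]
  | succ n ih =>
    have h := cc_succ n
    have : 0 < cc (n+1) * (n+1) := by rw [h]; positivity
    exact pos_of_mul_pos_left this (by positivity)

lemma cc_le (n : ℕ) : cc n ≤ 1 := by
  induction n with
  | zero => simp [cc_zero]
  | succ n ih =>
    have h := cc_succ n
    have := cc_pos n
    have hn : (0:ℝ) ≤ n := by positivity
    nlinarith

lemma cc_hasSum {z : ℝ} (hz : |z| < 1) :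
    HasSum (fun n => cc n * z ^ n) ((1 - z) ^ (-(1/2) : ℝ)) := by
  have h := Real.one_div_one_sub_rpow_hasFPowerSeriesOnBall_zero (1/2)
  have h2 := h.hasSum (y := z) (by
    simp [Metric.mem_eball, edist_zero_right]
    rw [← ofReal_norm]
    simpa using hz)
  have hz1 : 0 ≤ 1 - z := by linarith [(abs_lt.mp hz).2]
  rw [Real.rpow_neg hz1]
  convert! h2 using 1
  · ext n
    simp [FormalMultilinearSeries.ofScalars, cc, Ring.choose]
    left
    congr 1
    ring
  · simp

noncomputable def W (n : ℕ) : ℝ := ∫ t in (0:ℝ)..(π/2), Real.sin t ^ (2*n)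

lemma W_zero : W 0 = π/2 := by simp [W]

lemma W_succ (n : ℕ) : W (n+1) * (n+1) = W n * (n + 1/2) := by
  unfold W
  rw [show 2*(n+1) = 2*n+2 by ring, integral_sin_pow]
  simp
  field_simp

/-- Taylor coefficients of `K`. -/
noncomputable def aa (n : ℕ) : ℝ := cc n * W n

lemma aa_zero : aa 0 = π/2 := by simp [aa, cc_zero, W_zero]

lemma aa_succ (n : ℕ) : aa (n+1) * (n+1)^2 = aa n * (n+1/2)^2 := by
  unfold aa
  have h1 := cc_succ n
  have h2 := W_succ n
  linear_combination (W (n+1) * (n+1)) * h1 + cc n * (n+1/2) * h2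

lemma aa_pos (n : ℕ) : 0 < aa n := by
  induction n with
  | zero => rw [aa_zero]; positivity
  | succ n ih =>
    have h := aa_succ n
    have : 0 < aa (n+1) * (n+1)^2 := by rw [h]; positivity
    exact pos_of_mul_pos_left this (by positivity)

lemma aa_le (n : ℕ) : aa n ≤ 2 := by
  induction n with
  | zero => rw [aa_zero]; linarith [Real.pi_le_four]
  | succ n ih =>
    have h := aa_succ n
    have := aa_pos n
    have hn : (0:ℝ) ≤ n := by positivity
    have : aa (n+1) * (n+1)^2 ≤ 2 * (n+1)^2 := by
      rw [h]
      apply mul_le_mul ih _ (by positivity) (by norm_num)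
      gcongr; norm_num
    exact le_of_mul_le_mul_right this (by positivity)

lemma K_hasSum {y : ℝ} (hy : |y| < 1) : HasSum (fun n => aa n * y ^ n) (K y) := by
  have key := intervalIntegral.hasSum_integral_of_dominated_convergence
    (μ := MeasureTheory.volume) (a := 0) (b := π/2)
    (F := fun n t => cc n * (y * Real.sin t ^ 2) ^ n)
    (f := fun t => (1 - y * Real.sin t ^ 2) ^ (-(1/2) : ℝ))
    (fun n _ => |y| ^ n) ?_ ?_ ?_ ?_ ?_
  · convert! key using 1
    ext n
    simp only [mul_pow, ← pow_mul, intervalIntegral.integral_const_mul, aa, W]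
    ring
  · intro n
    exact (Continuous.aestronglyMeasurable (by fun_prop))
  · intro n
    refine Eventually.of_forall fun t _ => ?_
    rw [norm_mul, norm_pow, Real.norm_eq_abs, Real.norm_eq_abs, abs_of_pos (cc_pos n), abs_mul,
      abs_of_nonneg (sq_nonneg (Real.sin t))]
    have h1 : |y| * Real.sin t ^ 2 ≤ |y| :=
      mul_le_of_le_one_right (abs_nonneg _) (Real.sin_sq_le_one t)
    calc cc n * (|y| * Real.sin t ^ 2) ^ n ≤ 1 * |y| ^ n := by
          gcongr
          exact cc_le n
      _ = _ := one_mul _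
  · exact Eventually.of_forall fun t _ => summable_geometric_of_lt_one (abs_nonneg _) hy
  · simp
  · refine Eventually.of_forall fun t _ => cc_hasSum ?_
    rw [abs_mul, abs_of_nonneg (sq_nonneg (Real.sin t))]
    exact lt_of_le_of_lt (mul_le_of_le_one_right (abs_nonneg _) (Real.sin_sq_le_one t)) hy

lemma summable_poly (b : ℕ → ℝ) (C : ℝ) (k : ℕ) (hb : ∀ n, |b n| ≤ C * (n+1)^k) {y : ℝ}
    (hy : |y| < 1) : Summable (fun n => |b n| * |y| ^ n) := by
  have h0 := summable_pow_mul_geometric_of_norm_lt_one k (r := |y|) (by simpa using hy)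
  have h1 : Summable (fun n : ℕ => C * 2^k * ((n:ℝ)^k * |y|^n + |y|^n)) := 
    (h0.add (summable_geometric_of_lt_one (abs_nonneg _) hy)).mul_left _
  have hC : 0 ≤ C := by
    have := (abs_nonneg _).trans (hb 0)
    simpa using this
  refine Summable.of_nonneg_of_le (fun n => by positivity) (fun n => ?_) h1
  have h2 : ((n:ℝ)+1)^k ≤ 2^k * ((n:ℝ)^k + 1) := by
    rcases Nat.eq_zero_or_pos n with rfl | hn
    · have : (1:ℝ) ≤ 2^k := one_le_pow₀ (by norm_num)
      have h3 : (0:ℝ) ≤ 0^k := by positivity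
      simp only [Nat.cast_zero, zero_add, one_pow]
      nlinarith
    · have hn' : (1:ℝ) ≤ n := by exact_mod_cast hn
      calc ((n:ℝ)+1)^k ≤ (2 * n)^k := by gcongr; linarith
        _ = 2^k * (n:ℝ)^k := mul_pow _ _ _
        _ ≤ _ := by gcongr; linarith
  calc |b n| * |y| ^ n ≤ (C * (n+1)^k) * |y|^n := by gcongr; exact hb n
    _ ≤ (C * (2^k * ((n:ℝ)^k + 1))) * |y|^n := by gcongr
    _ = _ := by ring

lemma summable_poly' (b : ℕ → ℝ) (C : ℝ) (k : ℕ) (hb : ∀ n, |b n| ≤ C * (n+1)^k) {y : ℝ}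
    (hy : |y| < 1) : Summable (fun n => b n * y ^ n) := by
  refine Summable.of_norm ?_
  simpa [norm_mul, norm_pow] using summable_poly b C k hb hy

lemma shift_hasSum (u : ℕ → ℝ) (hu : u 0 = 0) {y S : ℝ}
    (h : HasSum (fun n => u (n+1) * y ^ n) S) : HasSum (fun n => u n * y ^ n) (y * S) := by
  rw [← hasSum_nat_add_iff' 1]
  simp only [Finset.sum_range_one, hu, zero_mul, sub_zero]
  convert! h.mul_left y using 1
  ext n; ring

lemma deriv_bound (b : ℕ → ℝ) (C : ℝ) (k : ℕ) (hb : ∀ n, |b n| ≤ C * (n+1)^k) (n : ℕ) :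
    |((n+1 : ℕ) : ℝ) * b (n+1)| ≤ (C * 2^k) * (n+1)^(k+1) := by
  have hC : 0 ≤ C := by
    have := (abs_nonneg _).trans (hb 0)
    simpa using this
  rw [abs_mul, abs_of_nonneg (by positivity)]
  push_cast
  have hn : (0:ℝ) ≤ n := by positivity
  have h := hb (n+1)
  push_cast at h
  calc ((n:ℝ)+1) * |b (n+1)| ≤ (n+1) * (C * (n+1+1)^k) := by gcongr
    _ ≤ (n+1) * (C * (2 * (n+1))^k) := by gcongr; linarith
    _ = _ := by rw [mul_pow]; ring

lemma hasDerivAt_series (b : ℕ → ℝ) (C : ℝ) (k : ℕ) (hb : ∀ n, |b n| ≤ C * (n+1)^k) {y : ℝ}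
    (hy : |y| < 1) :
    HasDerivAt (fun z => ∑' n, b n * z ^ n) (∑' n, (((n+1 : ℕ) : ℝ) * b (n+1)) * y ^ n) y := by
  obtain ⟨r, hyr, hr⟩ := exists_between hy
  have hr0 : 0 ≤ r := (abs_nonneg y).trans hyr.le
  have hrr : |r| < 1 := by rwa [abs_of_nonneg hr0]
  have hs := summable_poly (fun n => ((n+1 : ℕ) : ℝ) * b (n+1)) _ _ (deriv_bound b C k hb) hrr
  have hu : Summable (fun n : ℕ => |(n:ℝ) * b n| * |r| ^ (n-1)) := by
    rw [← summable_nat_add_iff 1]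
    simpa using hs
  have hd := hasDerivAt_tsum_of_isPreconnected (𝕜 := ℝ) (u := fun n : ℕ => |(n:ℝ) * b n| * |r| ^ (n-1)) 
    (g := fun n z => b n * z ^ n)
    (g' := fun n z => (n:ℝ) * b n * z ^ (n-1)) (t := Ioo (-r) r) (y₀ := y) (y := y)
    hu isOpen_Ioo isPreconnected_Ioo ?_ ?_ (abs_lt.mp hyr) ?_ (abs_lt.mp hyr)
  · convert! hd using 1
    have hsum : Summable (fun n : ℕ => (n:ℝ) * b n * y ^ (n-1)) := by
      rw [← summable_nat_add_iff 1]
      simpa using summable_poly' (fun n => ((n+1 : ℕ) : ℝ) * b (n+1)) _ _ (deriv_bound b C k hb) hy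
    rw [hsum.tsum_eq_zero_add]
    simp
  · intro n z _
    have := (hasDerivAt_pow n z).const_mul (b n)
    convert! this using 1; ring
  · intro n z hz
    rw [norm_mul, norm_pow, Real.norm_eq_abs, Real.norm_eq_abs]
    have : |z| ≤ |r| := by rw [abs_of_nonneg hr0]; exact (abs_lt.mpr hz).le
    gcongr
  · exact summable_poly' b C k hb hy

noncomputable def b1 (n : ℕ) : ℝ := ((n+1 : ℕ) : ℝ) * aa (n+1)
noncomputable def b2 (n : ℕ) : ℝ := ((n+1 : ℕ) : ℝ) * b1 (n+1)
noncomputable def K1 (y : ℝ) : ℝ := ∑' n, b1 n * y ^ n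
noncomputable def K2 (y : ℝ) : ℝ := ∑' n, b2 n * y ^ n

lemma aa_bound (n : ℕ) : |aa n| ≤ 2 * ((n:ℝ)+1)^0 := by
  rw [abs_of_pos (aa_pos n)]; simpa using aa_le n

lemma b1_bound (n : ℕ) : |b1 n| ≤ (2 * 2^0) * ((n:ℝ)+1)^(0+1) := deriv_bound aa 2 0 aa_bound n

lemma b2_bound (n : ℕ) : |b2 n| ≤ ((2 * 2^0) * 2^(0+1)) * ((n:ℝ)+1)^(0+1+1) :=
  deriv_bound b1 _ _ b1_bound n

lemma K1_hasSum {y : ℝ} (hy : |y| < 1) : HasSum (fun n => b1 n * y ^ n) (K1 y) :=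
  (summable_poly' b1 _ _ b1_bound hy).hasSum

lemma K2_hasSum {y : ℝ} (hy : |y| < 1) : HasSum (fun n => b2 n * y ^ n) (K2 y) :=
  (summable_poly' b2 _ _ b2_bound hy).hasSum

lemma K_hasDerivAt {y : ℝ} (hy : |y| < 1) : HasDerivAt K (K1 y) y := by
  have h := hasDerivAt_series aa 2 0 aa_bound hy
  refine h.congr_of_eventuallyEq ?_
  have : Ioo (-1:ℝ) 1 ∈ nhds y := isOpen_Ioo.mem_nhds (abs_lt.mp hy)
  filter_upwards [this] with z hz
  exact (K_hasSum (abs_lt.mpr hz)).tsum_eq.symm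

lemma K1_hasDerivAt {y : ℝ} (hy : |y| < 1) : HasDerivAt K1 (K2 y) y :=
  hasDerivAt_series b1 _ _ b1_bound hy

lemma yK1_hasSum {y : ℝ} (hy : |y| < 1) :
    HasSum (fun n : ℕ => ((n:ℝ) * aa n) * y ^ n) (y * K1 y) :=
  shift_hasSum (fun n : ℕ => (n:ℝ) * aa n) (by simp) (K1_hasSum hy)

lemma yK2_hasSum {y : ℝ} (hy : |y| < 1) :
    HasSum (fun n : ℕ => ((n:ℝ) * b1 n) * y ^ n) (y * K2 y) :=
  shift_hasSum (fun n : ℕ => (n:ℝ) * b1 n) (by simp) (K2_hasSum hy)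

lemma yyK2_hasSum {y : ℝ} (hy : |y| < 1) :
    HasSum (fun n : ℕ => ((n:ℝ) * ((n:ℝ) - 1) * aa n) * y ^ n) (y * (y * K2 y)) := by
  refine shift_hasSum (fun n : ℕ => (n:ℝ) * ((n:ℝ) - 1) * aa n) (by simp) ?_
  convert! yK2_hasSum hy using 1
  ext n
  simp only [b1]
  push_cast
  ring

lemma aa_succ' (n : ℕ) : aa (n+1) = aa n * ((n+1/2)^2 / (n+1)^2) := by
  have h := aa_succ n
  have : ((n:ℝ)+1)^2 ≠ 0 := by positivity
  field_simp
  linear_combination 4 * h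

lemma p_bound {p : ℝ} (hp : p ≥ 3 * (2 + Real.sqrt 2) / 8) :
    1.28 < p ∧ 0 ≤ p^2 - 1.5 * p + 9/32 := by
  have h2 : Real.sqrt 2 ^ 2 = 2 := Real.sq_sqrt (by norm_num)
  have h3 : 1.414 < Real.sqrt 2 := Real.lt_sqrt_of_sq_lt (by norm_num)
  constructor
  · linarith
  · nlinarith [mul_nonneg (sub_nonneg.mpr hp) (by linarith : (0:ℝ) ≤ p - 3 * (2 - Real.sqrt 2) / 8)]

noncomputable def cf (p : ℝ) (n : ℕ) : ℝ :=
  p^2 - p - (p-1)/(2*((n:ℝ)+1)) - 1/(2*((n:ℝ)+2)) + 1/(16*((n:ℝ)+1)*((n:ℝ)+2))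

lemma cf_nonneg {p : ℝ} (hp : p ≥ 3 * (2 + Real.sqrt 2) / 8) :
    0 ≤ cf p 0 ∧ ∀ n, 0 < cf p (n+1) := by
  obtain ⟨h1, h2⟩ := p_bound hp
  constructor
  · unfold cf; push_cast; norm_num; linarith
  · intro n
    unfold cf
    push_cast
    have hn : (0:ℝ) ≤ n := by positivity
    have e1 : (p-1)/(2*((n:ℝ)+1+1)) ≤ (p-1)/4 := by
      apply div_le_div_of_nonneg_left <;> linarith
    have e2 : 1/(2*((n:ℝ)+1+2)) ≤ 1/6 := by
      apply div_le_div_of_nonneg_left <;> linarith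
    have e3 : 0 < 1/(16*((n:ℝ)+1+1)*((n:ℝ)+1+2)) := by positivity
    nlinarith

lemma Q_hasSum (p : ℝ) {y : ℝ} (hy : |y| < 1) :
    HasSum (fun n : ℕ => aa n * cf p n * y ^ n)
      (p * (p-1) * K y - 2 * p * (1-y) * K1 y + (1-y)^2 * K2 y) := by
  have h := (((K_hasSum hy).mul_left (p*(p-1))).sub
    (((K1_hasSum hy).sub (yK1_hasSum hy)).mul_left (2*p))).add
    (((K2_hasSum hy).sub ((yK2_hasSum hy).mul_left 2)).add (yyK2_hasSum hy))
  convert! h using 1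
  · ext n
    simp only [b2, b1, cf, aa_succ']
    push_cast
    field_simp
    ring
  · ring

lemma Q_pos {p : ℝ} (hp : p ≥ 3 * (2 + Real.sqrt 2) / 8) {y : ℝ} (hy : y ∈ Ioo (0:ℝ) 1) :
    0 < p * (p-1) * K y - 2 * p * (1-y) * K1 y + (1-y)^2 * K2 y := by
  have hy' : |y| < 1 := by rw [abs_of_pos hy.1]; exact hy.2
  obtain ⟨h0, h1⟩ := cf_nonneg hp
  have hs := Q_hasSum p hy'
  rw [← hs.tsum_eq]
  refine hs.summable.tsum_pos (fun n => ?_) 1 ?_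
  · have := aa_pos n
    have hy0 := hy.1
    have : 0 ≤ cf p n := by
      cases n with
      | zero => exact h0
      | succ n => exact (h1 n).le
    positivity
  · exact mul_pos (mul_pos (aa_pos 1) (h1 0)) (pow_pos hy.1 _)

lemma R_neg {q : ℝ} (hq : 1/4 < q) {y : ℝ} (hy : y ∈ Ioo (0:ℝ) 1) :
    (1-y) * K1 y - q * K y < 0 := by
  have hy' : |y| < 1 := by rw [abs_of_pos hy.1]; exact hy.2
  have h := ((K_hasSum hy').mul_left q).sub ((K1_hasSum hy').sub (yK1_hasSum hy'))
  have hpos : ∀ n, 0 < q * (aa n * y ^ n) - (b1 n * y ^ n - (n:ℝ) * aa n * y ^ n) := by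
    intro n
    have e : q * (aa n * y ^ n) - (b1 n * y ^ n - (n:ℝ) * aa n * y ^ n)
      = aa n * y ^ n * (q - 1/(4*((n:ℝ)+1))) := by
      simp only [b1, aa_succ']
      push_cast
      field_simp
      ring
    rw [e]
    have hn : (0:ℝ) ≤ n := by positivity
    have : 1/(4*((n:ℝ)+1)) ≤ 1/4 := by
      apply div_le_div_of_nonneg_left <;> linarith
    exact mul_pos (mul_pos (aa_pos n) (pow_pos hy.1 _)) (by linarith)
  have := h.summable.tsum_pos (fun n => (hpos n).le) 0 (hpos 0)
  rw [h.tsum_eq] at this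
  linarith

lemma h_deriv (p : ℝ) {y : ℝ} (hy : y ∈ Ioo (-1:ℝ) 1) :
    HasDerivAt (fun z => (1-z)^p * K z) (-(p * (1-y)^(p-1)) * K y + (1-y)^p * K1 y) y := by
  have h1 : HasDerivAt (fun z : ℝ => (1-z)^p) (-(p * (1-y)^(p-1))) y := by
    have := ((hasDerivAt_id y).const_sub 1).rpow_const (p := p) (Or.inl (by
      simp only [id]; linarith [hy.2]))
    convert! this using 1
    simp
  exact h1.mul (K_hasDerivAt (abs_lt.mpr hy))

lemma h_deriv2 (p : ℝ) {y : ℝ} (hy : y ∈ Ioo (-1:ℝ) 1) :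
    HasDerivAt (fun z => -(p * (1-z)^(p-1)) * K z + (1-z)^p * K1 z)
      ((1-y)^(p-2) * (p * (p-1) * K y - 2 * p * (1-y) * K1 y + (1-y)^2 * K2 y)) y := by
  have hr : ∀ p : ℝ, HasDerivAt (fun z : ℝ => (1-z)^p) (-(p * (1-y)^(p-1))) y := by
    intro p
    have := ((hasDerivAt_id y).const_sub 1).rpow_const (p := p) (Or.inl (by
      simp only [id]; linarith [hy.2]))
    convert! this using 1
    simp
  have hk := K_hasDerivAt (abs_lt.mpr hy)
  have hk1 := K1_hasDerivAt (abs_lt.mpr hy)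
  have := ((((hr (p-1)).const_mul p).neg).mul hk).add ((hr p).mul hk1)
  convert! this using 1
  have hpos : 0 < 1 - y := by linarith [hy.2]
  have e1 : (1-y)^(p-1) = (1-y)^(p-2) * (1-y) := by
    rw [← Real.rpow_add_one hpos.ne']; congr 1; ring
  have e2 : (1-y)^p = (1-y)^(p-2) * (1-y)^2 := by
    rw [← Real.rpow_natCast, ← Real.rpow_add hpos]; congr 1; push_cast; ring
  rw [show p - 1 - 1 = p - 2 by ring, e1, e2]
  simp only [Pi.neg_apply]
  rw [e1]
  ring

lemma h_strictConvex {p : ℝ} (hp : p ≥ 3 * (2 + Real.sqrt 2) / 8) :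
    StrictConvexOn ℝ (Ioo (0:ℝ) 1) (fun z => (1-z)^p * K z) := by
  have hsub : ∀ y ∈ Ioo (0:ℝ) 1, y ∈ Ioo (-1:ℝ) 1 := fun y hy => ⟨by linarith [hy.1], hy.2⟩
  apply StrictMonoOn.strictConvexOn_of_deriv (convex_Ioo _ _)
  · exact fun y hy => (h_deriv p (hsub y hy)).continuousAt.continuousWithinAt
  · rw [interior_Ioo]
    have hm : StrictMonoOn (fun z => -(p * (1-z)^(p-1)) * K z + (1-z)^p * K1 z)
        (Ioo (0:ℝ) 1) := by
      apply strictMonoOn_of_deriv_pos (convex_Ioo _ _)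
      · exact fun y hy => (h_deriv2 p (hsub y hy)).continuousAt.continuousWithinAt
      · rw [interior_Ioo]
        intro y hy
        rw [(h_deriv2 p (hsub y hy)).deriv]
        exact mul_pos (Real.rpow_pos_of_pos (by linarith [hy.2]) _) (Q_pos hp hy)
    intro x hx y hy hxy
    rw [(h_deriv p (hsub x hx)).deriv, (h_deriv p (hsub y hy)).deriv]
    exact hm hx hy hxy

lemma K_zero : K 0 = π/2 := by simp [K]

lemma h_upper {p : ℝ} (hp : p ≥ 3 * (2 + Real.sqrt 2) / 8) {y : ℝ} (hy : y ∈ Ioo (0:ℝ) 1) :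
    (1-y)^p * K y < (1-y) * (π/2) := by
  obtain ⟨h1, -⟩ := p_bound hp
  have hsub : ∀ y ∈ Ico (0:ℝ) 1, y ∈ Ioo (-1:ℝ) 1 := fun y hy => ⟨by linarith [hy.1], hy.2⟩
  have hanti : StrictAntiOn (fun z => (1-z)^(p-1) * K z) (Ico (0:ℝ) 1) := by
    apply strictAntiOn_of_deriv_neg (convex_Ico _ _)
    · exact fun y hy => (h_deriv _ (hsub y hy)).continuousAt.continuousWithinAt
    · rw [interior_Ico]
      intro z hz
      rw [(h_deriv (p-1) (hsub z ⟨hz.1.le, hz.2⟩)).deriv]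
      have hpos : 0 < 1 - z := by linarith [hz.2]
      have e1 : (1-z)^(p-1) = (1-z)^(p-1-1) * (1-z) := by
        rw [← Real.rpow_add_one hpos.ne']; congr 1; ring
      have hR := R_neg (q := p-1) (by linarith) hz
      have := mul_neg_of_pos_of_neg (Real.rpow_pos_of_pos hpos (p-1-1)) hR
      rw [e1]
      linarith
  have h := hanti (left_mem_Ico.mpr one_pos) ⟨hy.1.le, hy.2⟩ hy.1
  simp only [sub_zero, Real.one_rpow, one_mul, K_zero] at h
  have hpos : 0 < 1 - y := by linarith [hy.2]
  have e1 : (1-y)^p = (1-y) * (1-y)^(p-1) := by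
    rw [mul_comm, ← Real.rpow_add_one hpos.ne']; congr 1; ring
  rw [e1, mul_assoc]
  exact mul_lt_mul_of_pos_left h hpos

theorem stmt17 (p : ℝ) (hp : p ≥ 3 * (2 + Real.sqrt 2) / 8) :
    ∀ r ∈ Ioo (0 : ℝ) 1,
      (K (1/2) / 2 ^ (p - 1) ≤ r ^ p * K (1 - r) + (1 - r) ^ p * K r ∧
       r ^ p * K (1 - r) + (1 - r) ^ p * K r < π / 2) ∧
      (K (1/2) / 2 ^ (p - 1) = r ^ p * K (1 - r) + (1 - r) ^ p * K r → r = 1/2) := by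
  intro r hr
  have hr' : 1 - r ∈ Ioo (0:ℝ) 1 := ⟨by linarith [hr.2], by linarith [hr.1]⟩
  have e0 : K (1/2) / 2 ^ (p-1) = 2 * ((1/2)^p * K (1/2)) := by
    rw [Real.rpow_sub_one (by norm_num), one_div, Real.inv_rpow (by norm_num)]
    field_simp
  have hlt : r ≠ 1/2 → K (1/2) / 2 ^ (p - 1) < r ^ p * K (1 - r) + (1 - r) ^ p * K r := by
    intro hne
    have h := (h_strictConvex hp).2 hr hr' (fun h => hne (by linarith))
      (show (0:ℝ) < 1/2 by norm_num) (show (0:ℝ) < 1/2 by norm_num) (by norm_num)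
    simp only [smul_eq_mul] at h
    rw [show (1/2 : ℝ) * r + 1/2 * (1-r) = 1/2 by ring, show (1:ℝ) - 1/2 = 1/2 by norm_num,
      show 1 - (1 - r) = r by ring] at h
    rw [e0]
    linarith
  refine ⟨⟨?_, ?_⟩, ?_⟩
  · by_cases h : r = 1/2
    · rw [e0, h, show (1:ℝ) - 1/2 = 1/2 by norm_num]; linarith
    · exact (hlt h).le
  · have u1 := h_upper hp hr
    have u2 := h_upper hp hr'
    rw [show 1 - (1 - r) = r by ring] at u2
    linarith
  · intro h
    by_contra hne
    exact (hlt hne).ne h
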